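/- Let p be a prime and let G be a finite non-abelian p-group (i.e. |G| is a power of p). Then D(G) ≤ ((p² + 2p − 2)/p³)·|G|. -/

import Mathlib

/-- The set of all products of the terms of the multiset `S` taken in some order. -/
def prodSet {G : Type*} [Group G] (S : Multiset G) : Set G :=
  {g | ∃ l : List G, (l : Multiset G) = S ∧ l.prod = g}

/-- A sequence (multiset) over `G` is a product-one sequence if its terms can be
ordered so that their product is `1`. -/
def IsProductOne {G : Type*} [Group G] (S : Multiset G) : Prop :=
  (1 : G) ∈ prodSet S

/-- A minimal product-one sequence (atom): a nontrivial product-one sequence that cannot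
be partitioned into two nontrivial product-one subsequences. -/
def IsMinimalProductOne {G : Type*} [Group G] (S : Multiset G) : Prop :=
  S ≠ 0 ∧ IsProductOne S ∧
    ¬ ∃ T₁ T₂ : Multiset G, T₁ ≠ 0 ∧ T₂ ≠ 0 ∧ S = T₁ + T₂ ∧
      IsProductOne T₁ ∧ IsProductOne T₂

/-- The small Davenport constant: the maximal length of a sequence over `G` having
no nontrivial product-one subsequence. -/
noncomputable def smallDavenport (G : Type*) [Group G] : ℕ :=
  sSup {n | ∃ S : Multiset G, Multiset.card S = n ∧
    ∀ T : Multiset G, T ≤ S → T ≠ 0 → ¬ IsProductOne T}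

/-- The large Davenport constant: the maximal length of a minimal product-one sequence. -/
noncomputable def largeDavenport (G : Type*) [Group G] : ℕ :=
  sSup {n | ∃ S : Multiset G, Multiset.card S = n ∧ IsMinimalProductOne S}

lemma exists_le_card_eq {α : Type*} {S : Multiset α} {n : ℕ} (h : n ≤ Multiset.card S) :
    ∃ T ≤ S, Multiset.card T = n := by
  induction S using Quotient.inductionOn with
  | h l => exact ⟨l.take n, (List.take_sublist n l).subperm, by simpa using h⟩

open MvPolynomial in
/-- Olson's theorem for elementary abelian `p`-groups: a sequence of more than `r * (p - 1)` vectors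
of `(ZMod p) ^ r` has a nonempty zero-sum subsequence. -/
lemma exists_le_sum_map_eq_zero {p : ℕ} [Fact p.Prime] {α : Type*} {r : ℕ} (S : Multiset α)
    (v : α → Fin r → ZMod p) (h : r * (p - 1) < Multiset.card S) :
    ∃ T ≤ S, T ≠ 0 ∧ (T.map v).sum = 0 := by
  classical
  have hp : p.Prime := Fact.out
  let f : Fin r → MvPolynomial S (ZMod p) := fun j => ∑ i : S, v i.1 j • X i ^ (p - 1)
  have hdeg : ∑ j, (f j).totalDegree < Fintype.card S := by
    calc ∑ j, (f j).totalDegree ≤ ∑ _j : Fin r, (p - 1) := by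
          gcongr
          apply totalDegree_finsetSum_le
          rintro i _
          exact (totalDegree_smul_le ..).trans (totalDegree_X_pow ..).le
      _ < _ := by simpa using h
  have hdvd := char_dvd_card_solutions_of_sum_lt p (s := Finset.univ) (f := f) hdeg
  let x₀ : {x : S → ZMod p // ∀ j ∈ Finset.univ, eval x (f j) = 0} :=
    ⟨0, by simp [f, hp.one_lt, tsub_eq_zero_iff_le]⟩
  rw [@Fintype.card_eq_nat_card] at hdvd
  have : Nonempty {x : S → ZMod p // ∀ j ∈ Finset.univ, eval x (f j) = 0} := ⟨x₀⟩
  have := Finite.one_lt_card_iff_nontrivial.1 (hp.one_lt.trans_le (Nat.le_of_dvd Nat.card_pos hdvd))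
  obtain ⟨x, hx⟩ := exists_ne x₀
  let t : Finset S := {a | x.1 a ≠ 0}
  refine ⟨t.val.map fun a => a.1, ?_, ?_, ?_⟩
  · conv_rhs => rw [← Multiset.map_univ_coe S]
    exact Multiset.map_le_map (Finset.val_le_iff.2 (Finset.subset_univ t))
  · rw [← Subtype.coe_ne_coe, Function.ne_iff] at hx
    obtain ⟨a, ha⟩ := hx
    intro h0
    rw [Multiset.map_eq_zero, Finset.val_eq_zero] at h0
    have : a ∈ t := by simpa [t, x₀] using ha
    simp [h0] at this
  · rw [Multiset.map_map]
    change ∑ a ∈ t, v a.1 = 0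
    ext j
    simpa [f, t, ZMod.pow_card_sub_one, Finset.sum_filter, Finset.sum_apply, apply_ite] using
      x.2 j (Finset.mem_univ j)

/-- A sequence of at least `3 * p - 2` vectors of `(ZMod p) ^ 2` has a nonempty zero-sum
subsequence of length at most `p`. -/
lemma exists_short_sum_map_eq_zero {p : ℕ} [Fact p.Prime] {α : Type*} (S : Multiset α)
    (v : α → Fin 2 → ZMod p) (h : 3 * p - 2 ≤ Multiset.card S) :
    ∃ T ≤ S, T ≠ 0 ∧ Multiset.card T ≤ p ∧ (T.map v).sum = 0 := by
  classical
  have hp : p.Prime := Fact.out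
  have h2 := hp.two_le
  obtain ⟨S₀, hS₀, hcard⟩ := exists_le_card_eq h
  obtain ⟨T, hT, hT0, hsum⟩ := exists_le_sum_map_eq_zero (p := p) S₀
    (fun a => (Fin.cons 1 (v a) : Fin 3 → ZMod p)) (by omega)
  have hcT := Multiset.card_le_card hT
  have hzero : (T.map v).sum = 0 := by
    ext j
    have := congrFun hsum j.succ
    rw [Pi.multiset_sum_apply, Multiset.map_map] at this ⊢
    simpa [Function.comp_def] using this
  have hdvd : p ∣ Multiset.card T := by
    have := congrFun hsum 0
    rw [Pi.multiset_sum_apply, Multiset.map_map] at this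
    rw [← CharP.cast_eq_zero_iff (ZMod p)]
    simpa [Function.comp_def] using this
  obtain ⟨k, hk⟩ := hdvd
  by_cases hTp : Multiset.card T ≤ p
  · exact ⟨T, hT.trans hS₀, hT0, hTp, hzero⟩
  have hk2 : k = 2 := by
    have : k < 3 := by by_contra! hk3; have := Nat.mul_le_mul_left p hk3; omega
    interval_cases k <;> omega
  subst hk2
  obtain ⟨a, ha⟩ := Multiset.exists_mem_of_ne_zero hT0
  obtain ⟨T', rfl⟩ := Multiset.exists_cons_of_mem ha
  rw [Multiset.card_cons] at hk
  obtain ⟨Q, hQ, hQ0, hQs⟩ := exists_le_sum_map_eq_zero (p := p) T' v (by omega)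
  have hQT : Q ≤ a ::ₘ T' := hQ.trans (Multiset.le_cons_self _ _)
  by_cases hQp : Multiset.card Q ≤ p
  · exact ⟨Q, hQT.trans (hT.trans hS₀), hQ0, hQp, hQs⟩
  have hc : Multiset.card ((a ::ₘ T') - Q) = Multiset.card T' + 1 - Multiset.card Q := by
    rw [Multiset.card_sub hQT, Multiset.card_cons]
  have hQc := Multiset.card_le_card hQ
  refine ⟨(a ::ₘ T') - Q, (Multiset.sub_le_self _ _).trans (hT.trans hS₀), ?_, by omega, ?_⟩
  · rw [← Multiset.card_pos]; omega
  · rw [← Multiset.sub_add_cancel hQT, Multiset.map_add, Multiset.sum_add, hQs, add_zero] at hzero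
    exact hzero

section Multisets

variable {α β : Type*}

lemma exists_list_map_eq {f : α → β} {l : List β} {B : Multiset α}
    (h : (l : Multiset β) = B.map f) : ∃ L : List α, (L : Multiset α) = B ∧ L.map f = l := by
  classical
  induction l generalizing B with
  | nil => exact ⟨[], by simpa [eq_comm] using h, rfl⟩
  | cons b l ih =>
    have hb : b ∈ B.map f := h ▸ by simp
    obtain ⟨a, ha, rfl⟩ := Multiset.mem_map.1 hb
    obtain ⟨B', rfl⟩ := Multiset.exists_cons_of_mem ha
    rw [Multiset.map_cons, ← Multiset.cons_coe, Multiset.cons_inj_right] at h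
    obtain ⟨L, rfl, rfl⟩ := ih h
    exact ⟨a :: L, rfl, rfl⟩

lemma exists_add_of_map_eq_add {f : α → β} {S : Multiset α} {T U : Multiset β}
    (h : S.map f = T + U) : ∃ S₁ S₂, S = S₁ + S₂ ∧ S₁.map f = T ∧ S₂.map f = U := by
  obtain ⟨t, rfl⟩ := Quot.exists_rep T
  obtain ⟨u, rfl⟩ := Quot.exists_rep U
  obtain ⟨L, rfl, hL⟩ := exists_list_map_eq (l := t ++ u) (B := S) (f := f) h.symm
  obtain ⟨L₁, L₂, rfl, rfl, rfl⟩ := List.map_eq_append_iff.1 hL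
  exact ⟨L₁, L₂, rfl, rfl, rfl⟩

lemma sum_map_coe_ne_zero {B : Multiset (List α)} (hB : B ≠ 0) (h : ∀ b ∈ B, b ≠ []) :
    (B.map fun l : List α => (l : Multiset α)).sum ≠ 0 := by
  obtain ⟨b, hb⟩ := Multiset.exists_mem_of_ne_zero hB
  obtain ⟨B', rfl⟩ := Multiset.exists_cons_of_mem hb
  have := h b hb
  simp [this]

lemma sum_map_coe (L : List (List α)) :
    ((L : Multiset (List α)).map fun l : List α => (l : Multiset α)).sum =
      (L.flatten : Multiset α) := by
  induction L with
  | nil => rfl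
  | cons a L ih =>
    rw [← Multiset.cons_coe, Multiset.map_cons, Multiset.sum_cons, ih, List.flatten_cons,
      Multiset.coe_add]

end Multisets

section ProductSets

variable {G H : Type*} [Group G] [Group H]

lemma mul_mem_prodSet_add {S T : Multiset G} {a b : G} (ha : a ∈ prodSet S) (hb : b ∈ prodSet T) :
    a * b ∈ prodSet (S + T) := by
  obtain ⟨s, rfl, rfl⟩ := ha
  obtain ⟨t, rfl, rfl⟩ := hb
  exact ⟨s ++ t, by simp, by simp⟩

lemma IsProductOne.map {S : Multiset G} (h : IsProductOne S) (f : G →* H) :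
    IsProductOne (S.map f) := by
  obtain ⟨s, rfl, hs⟩ := h
  exact ⟨s.map f, by simp, by rw [← map_list_prod, hs, map_one]⟩

lemma IsProductOne.of_map {S : Multiset G} {f : G →* H} (hf : Function.Injective f)
    (h : IsProductOne (S.map f)) : IsProductOne S := by
  obtain ⟨s, hs, h1⟩ := h
  obtain ⟨L, rfl, rfl⟩ := exists_list_map_eq hs
  exact ⟨L, rfl, hf (by rw [map_list_prod, h1, map_one])⟩

/-- Replacing the terms of a product-one sequence by lists with the respective products gives a
product-one sequence. -/
lemma IsProductOne.sum_of_map_prod {B : Multiset (List G)} (h : IsProductOne (B.map List.prod)) :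
    IsProductOne (B.map fun l : List G => (l : Multiset G)).sum := by
  obtain ⟨s, hs, h1⟩ := h
  obtain ⟨L, rfl, rfl⟩ := exists_list_map_eq hs
  exact ⟨L.flatten, (sum_map_coe L).symm, by rw [List.prod_flatten, h1]⟩

end ProductSets

section Subgroups

variable {G : Type*} [Group G]

/-- The products of the nonempty suffixes of a list. -/
def suffixProds : List G → List G
  | [] => []
  | g :: l => (g :: l).prod :: suffixProds l

lemma length_suffixProds (l : List G) : (suffixProds l).length = l.length := by
  induction l with
  | nil => rfl
  | cons g l ih => simp [suffixProds, ih]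

/-- Cutting a list at the places where its suffix products visit a given right coset of `H`
(encoded by the left coset of the inverse). -/
lemma exists_cut (H : Subgroup G) [DecidableEq (G ⧸ H)] (q : G ⧸ H) (l : List G) :
    ((suffixProds l).map fun g => ((g⁻¹ : G) : G ⧸ H)).count q = 0 ∨
    ∃ (r : List G) (L : List (List G)) (t : List G), l = r ++ L.flatten ++ t ∧ t ≠ [] ∧
      (∀ b ∈ L, b ≠ [] ∧ b.prod ∈ H) ∧ (((L.flatten ++ t).prod⁻¹ : G) : G ⧸ H) = q ∧
      ((suffixProds l).map fun g => ((g⁻¹ : G) : G ⧸ H)).count q = L.length + 1 := by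
  induction l with
  | nil => left; rfl
  | cons g l ih =>
    by_cases hq : (((g :: l).prod⁻¹ : G) : G ⧸ H) = q
    · right
      have hcount : ((suffixProds (g :: l)).map fun g => ((g⁻¹ : G) : G ⧸ H)).count q =
          ((suffixProds l).map fun g => ((g⁻¹ : G) : G ⧸ H)).count q + 1 := by
        rw [suffixProds, List.map_cons, hq, List.count_cons_self]
      rcases ih with h0 | ⟨r, L, t, rfl, ht, hL, hq', hc⟩
      · exact ⟨[], [], g :: l, by simp, by simp, by simp, by simpa using hq, by
          rw [hcount, h0]; rfl⟩
      · refine ⟨[], (g :: r) :: L, t, by simp, ht, ?_, by simpa [mul_assoc] using hq, by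
          rw [hcount, hc]; rfl⟩
        rw [List.forall_mem_cons]
        refine ⟨⟨by simp, ?_⟩, hL⟩
        have := QuotientGroup.eq.1 (hq.trans hq'.symm)
        simpa [mul_assoc] using this
    · have hcount : ((suffixProds (g :: l)).map fun g => ((g⁻¹ : G) : G ⧸ H)).count q =
          ((suffixProds l).map fun g => ((g⁻¹ : G) : G ⧸ H)).count q := by
        rw [suffixProds, List.map_cons, List.count_cons_of_ne hq]
      rw [hcount]
      refine ih.imp_right ?_
      rintro ⟨r, L, t, rfl, ht, hL, hq', hc⟩
      exact ⟨g :: r, L, t, by simp, ht, hL, hq', hc⟩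

/-- An upper bound for the lengths of minimal product-one sequences over a subgroup gives, after
multiplication by the index, a bound over the group. -/
lemma IsMinimalProductOne.card_le_index_mul [Finite G] (H : Subgroup G) {k : ℕ}
    (hk : ∀ T : Multiset H, IsMinimalProductOne T → Multiset.card T ≤ k) {S : Multiset G}
    (hS : IsMinimalProductOne S) : Multiset.card S ≤ H.index * k := by
  classical
  obtain ⟨-, ⟨l, rfl, hl⟩, hmin⟩ := hS
  by_contra! hlt
  have := Fintype.ofFinite (G ⧸ H)
  obtain ⟨q, hq⟩ : ∃ q : G ⧸ H,
      k < ((suffixProds l).map fun g => ((g⁻¹ : G) : G ⧸ H)).count q := by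
    by_contra! hall
    have hsum := Multiset.sum_count_eq_card (s := Finset.univ)
      (m := (((suffixProds l).map fun g => ((g⁻¹ : G) : G ⧸ H) : List (G ⧸ H)) :
        Multiset (G ⧸ H))) (by simp)
    have hle := Finset.sum_le_card_nsmul Finset.univ
      (fun q => ((suffixProds l).map fun g => ((g⁻¹ : G) : G ⧸ H)).count q) k
      (fun q _ => hall q)
    simp only [Multiset.coe_count, Multiset.coe_card, List.length_map,
      length_suffixProds] at hsum
    rw [hsum, Finset.card_univ, ← Nat.card_eq_fintype_card, smul_eq_mul] at hle
    exact absurd hlt (not_lt.2 hle)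
  obtain h0 | ⟨r, L, t, rfl, ht, hL, -, hc⟩ := exists_cut H q l
  · omega
  have hprod : L.flatten.prod * (t ++ r).prod = 1 := by
    rw [List.append_assoc, List.prod_append] at hl
    rw [← mul_eq_one_iff_eq_inv.2 (eq_inv_of_mul_eq_one_right hl)]
    simp [mul_assoc]
  have hflat : L.flatten.prod ∈ H := by
    rw [List.prod_flatten]
    refine Subgroup.list_prod_mem _ fun x hx => ?_
    obtain ⟨b, hb, rfl⟩ := List.mem_map.1 hx
    exact (hL b hb).2
  have hlast : t ++ r ≠ [] ∧ (t ++ r).prod ∈ H :=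
    ⟨by simp [ht], by rw [eq_inv_of_mul_eq_one_right hprod]; exact inv_mem hflat⟩
  lift L to List {b : List G // b ≠ [] ∧ b.prod ∈ H} using hL
  let B : Multiset {b : List G // b ≠ [] ∧ b.prod ∈ H} :=
    ((L ++ [⟨t ++ r, hlast⟩] : List _) : Multiset _)
  let J : Multiset {b : List G // b ≠ [] ∧ b.prod ∈ H} → Multiset G :=
    fun C => ((C.map Subtype.val).map fun l : List G => (l : Multiset G)).sum
  let f : {b : List G // b ≠ [] ∧ b.prod ∈ H} → H := fun b => ⟨b.1.prod, b.2.2⟩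
  have hJB : J B = ((r ++ (L.map Subtype.val).flatten ++ t : List G) : Multiset G) := by
    simp only [J, B]
    rw [Multiset.map_coe, sum_map_coe, Multiset.coe_eq_coe, List.map_append, List.flatten_append]
    simp only [List.map_cons, List.map_nil, List.flatten_cons, List.flatten_nil, List.append_nil]
    rw [List.append_assoc r, ← List.append_assoc]
    exact List.perm_append_comm
  have hBone : IsProductOne (B.map f) := by
    refine ⟨_, (Multiset.map_coe _ _).symm, ?_⟩
    ext
    rw [List.prod_flatten] at hprod
    simpa [f, Function.comp_def] using hprod
  have hJone (C) (hC : IsProductOne (C.map f)) : IsProductOne (J C) := by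
    refine IsProductOne.sum_of_map_prod ?_
    have := hC.map H.subtype
    simpa [Multiset.map_map, f, Function.comp_def] using this
  have hJne (C) (hC : C ≠ 0) : J C ≠ 0 :=
    sum_map_coe_ne_zero (by simpa using hC) fun b hb => by
      obtain ⟨x, -, rfl⟩ := Multiset.mem_map.1 hb
      exact x.2.1
  have hnot : ¬ IsMinimalProductOne (B.map f) := fun h => by
    have := hk _ h
    simp [B] at this
    rw [List.length_map] at hc
    omega
  apply hnot
  refine ⟨by simp [B], hBone, ?_⟩
  rintro ⟨T₁, T₂, h₁, h₂, h, h1₁, h1₂⟩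
  obtain ⟨B₁, B₂, hB, rfl, rfl⟩ := exists_add_of_map_eq_add h
  refine hmin ⟨J B₁, J B₂, hJne _ (by simpa using h₁), hJne _ (by simpa using h₂), ?_,
    hJone _ h1₁, hJone _ h1₂⟩
  rw [← hJB, hB]
  simp [J]

/-- A minimal product-one sequence has at most `|G|` terms. -/
lemma IsMinimalProductOne.card_le [Finite G] {S : Multiset G} (hS : IsMinimalProductOne S) :
    Multiset.card S ≤ Nat.card G := by
  have := hS.card_le_index_mul (⊥ : Subgroup G) (k := 1) ?_
  · simpa using this
  rintro T ⟨-, -, hT⟩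
  by_contra! hlt
  have hone (U : Multiset (⊥ : Subgroup G)) : IsProductOne U := by
    obtain ⟨l, rfl⟩ := Quot.exists_rep U
    exact ⟨l, rfl, Subsingleton.elim _ _⟩
  obtain ⟨a, ha⟩ := Multiset.card_pos_iff_exists_mem.1 (by omega : 0 < Multiset.card T)
  obtain ⟨T', rfl⟩ := Multiset.exists_cons_of_mem ha
  refine hT ⟨{a}, T', by simp, ?_, by simp, hone _, hone _⟩
  rintro rfl
  simp at hlt

/-- A minimal product-one sequence whose terms lie in `H` has at most `|H|` terms. -/
lemma IsMinimalProductOne.card_le_of_forall_mem [Finite G] {S : Multiset G}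
    (hS : IsMinimalProductOne S) (H : Subgroup G) (h : ∀ g ∈ S, g ∈ H) :
    Multiset.card S ≤ Nat.card H := by
  lift S to Multiset H using h
  obtain ⟨h0, h1, hmin⟩ := hS
  have hmap (U : Multiset H) : U.map H.subtype = U.map Subtype.val := rfl
  rw [Multiset.card_map]
  refine IsMinimalProductOne.card_le ⟨by simpa using h0, ?_, ?_⟩
  · exact IsProductOne.of_map H.subtype_injective h1
  · rintro ⟨T₁, T₂, h₁, h₂, rfl, h1₁, h1₂⟩
    exact hmin ⟨T₁.map H.subtype, T₂.map H.subtype, by simpa using h₁, by simpa using h₂,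
      by simp, h1₁.map _, h1₂.map _⟩

end Subgroups

section SubsetSums

open Pointwise in
/-- A sequence of nonzero elements of `ZMod p` of length at least `p - 1` has every element as a
subsequence sum. -/
lemma exists_add_sum_map_eq {p : ℕ} [Fact p.Prime] {α : Type*} {X : Multiset α} {f : α → ZMod p}
    (hf : ∀ x ∈ X, f x ≠ 0) (hX : p - 1 ≤ Multiset.card X) (d : ZMod p) :
    ∃ X₁ X₂, X = X₁ + X₂ ∧ (X₁.map f).sum = d := by
  classical
  have hp : p.Prime := Fact.out
  obtain ⟨A, hcard, hA⟩ : ∃ A : Finset (ZMod p), min p (Multiset.card X + 1) ≤ A.card ∧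
      ∀ d ∈ A, ∃ X₁ X₂, X = X₁ + X₂ ∧ (X₁.map f).sum = d := by
    clear hX
    induction X using Multiset.induction with
    | empty => exact ⟨{0}, by simp, fun d hd => ⟨0, 0, by simp, by simpa [eq_comm] using hd⟩⟩
    | cons x X ih =>
      obtain ⟨A, hcard, hA⟩ := ih fun z hz => hf z (Multiset.mem_cons_of_mem hz)
      have hne : A.Nonempty := by
        rw [← Finset.card_pos]
        have := hp.pos
        omega
      have hcd := ZMod.cauchy_davenport hp (s := A) (t := {0, f x}) hne (by simp)
      have hx := hf x (Multiset.mem_cons_self x X)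
      rw [Finset.card_pair hx.symm] at hcd
      refine ⟨A + {0, f x}, by rw [Multiset.card_cons]; omega, ?_⟩
      intro d hd
      obtain ⟨a, ha, b, hb, rfl⟩ := Finset.mem_add.1 hd
      obtain ⟨X₁, X₂, rfl, rfl⟩ := hA a ha
      rw [Finset.mem_insert, Finset.mem_singleton] at hb
      rcases hb with rfl | rfl
      · exact ⟨X₁, x ::ₘ X₂, by simp, by simp⟩
      · exact ⟨x ::ₘ X₁, X₂, by simp, by simp [add_comm]⟩
  have hAuniv : A = Finset.univ := by
    rw [← Finset.card_eq_iff_eq_univ, ZMod.card]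
    have := A.card_le_univ
    rw [ZMod.card] at this
    omega
  exact hA d (hAuniv ▸ Finset.mem_univ d)

end SubsetSums

section ProductOneSubsequences

variable {G : Type*} [Group G]

/-- A sequence of at least `|G|` terms has a nontrivial product-one subsequence. -/
lemma exists_le_isProductOne [Finite G] (S : Multiset G) (hS : Nat.card G ≤ Multiset.card S) :
    ∃ T ≤ S, T ≠ 0 ∧ IsProductOne T := by
  obtain ⟨l, rfl⟩ := Quot.exists_rep S
  change Nat.card G ≤ l.length at hS
  have := Fintype.ofFinite G
  obtain ⟨i, j, hij, h⟩ := Fintype.exists_ne_map_eq_of_card_lt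
    (fun i : Fin (l.length + 1) => (l.take i).prod) (by
      rw [Fintype.card_fin, ← Nat.card_eq_fintype_card]; omega)
  wlog hlt : i < j generalizing i j
  · exact this j i hij.symm h.symm (lt_of_le_of_ne (not_lt.1 hlt) hij.symm)
  have hlt' : (i : ℕ) < j := hlt
  refine ⟨((l.take j).drop i : List G),
    ((List.drop_sublist _ _).trans (List.take_sublist _ _)).subperm, ?_, _, rfl, ?_⟩
  · rw [Ne, Multiset.coe_eq_zero, ← List.length_eq_zero_iff, List.length_drop, List.length_take]
    have := j.2
    omega
  · have h1 := List.prod_take_mul_prod_drop (l.take j) i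
    rw [List.take_take, min_eq_left hlt'.le] at h1
    change (l.take i).prod = (l.take j).prod at h
    rwa [h, mul_eq_left] at h1

/-- Removing central terms with product one from a product-one sequence. -/
lemma IsProductOne.of_add_central {T R : Multiset G} (hT : ∀ g ∈ T, g ∈ Subgroup.center G)
    (h1 : IsProductOne T) (h : IsProductOne (T + R)) : IsProductOne R := by
  have key (t : List G) (ht : ∀ g ∈ t, g ∈ Subgroup.center G) (R : Multiset G) (g : G)
      (hg : g ∈ prodSet ((t : Multiset G) + R)) : t.prod⁻¹ * g ∈ prodSet R := by
    induction t generalizing R with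
    | nil => simpa using hg
    | cons x t ih =>
      rw [List.forall_mem_cons] at ht
      obtain ⟨l, hl, hg'⟩ := ih ht.2 (x ::ₘ R) (by simpa [← Multiset.cons_coe] using hg)
      have hx : x ∈ l := by rw [← Multiset.mem_coe, hl]; simp
      obtain ⟨l₁, l₂, rfl⟩ := List.append_of_mem hx
      refine ⟨l₁ ++ l₂, ?_, ?_⟩
      · rw [← Multiset.cons_inj_right x, ← hl, Multiset.cons_coe, Multiset.coe_eq_coe]
        exact List.perm_middle.symm
      · rw [List.prod_append, List.prod_cons, ← mul_assoc, Subgroup.mem_center_iff.1 ht.1,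
          mul_assoc] at hg'
        rw [List.prod_cons, ← Subgroup.mem_center_iff.1 ht.1, mul_inv_rev, mul_assoc, ← hg',
          inv_mul_cancel_left, List.prod_append]
  obtain ⟨t, rfl, ht1⟩ := h1
  have := key t hT R 1 h
  rwa [ht1, inv_one, one_mul] at this

/-- A minimal product-one sequence that is not central has fewer than `|Z(G)|` central terms. -/
lemma IsMinimalProductOne.card_filter_center_lt [Finite G] {S : Multiset G}
    (hS : IsMinimalProductOne S) (hcard : Nat.card (Subgroup.center G) < Multiset.card S)
    [DecidablePred (· ∈ Subgroup.center G)] :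
    Multiset.card (S.filter (· ∈ Subgroup.center G)) < Nat.card (Subgroup.center G) := by
  by_contra! hle
  obtain ⟨C, hC, hCcard⟩ := exists_le_card_eq hle
  have hCS := hC.trans (Multiset.filter_le _ _)
  have hmem : ∀ g ∈ C, g ∈ Subgroup.center G := fun g hg =>
    (Multiset.mem_filter.1 (Multiset.mem_of_le hC hg)).2
  lift C to Multiset (Subgroup.center G) using hmem
  obtain ⟨T, hT, hT0, hT1⟩ := exists_le_isProductOne C (by simpa using hCcard.ge)
  have hTcard := Multiset.card_le_card hT
  rw [Multiset.card_map] at hCcard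
  obtain ⟨R, rfl⟩ := Multiset.le_iff_exists_add.1 ((Multiset.map_le_map hT).trans hCS)
  have hT1' : IsProductOne (T.map Subtype.val) := hT1.map (Subgroup.center G).subtype
  refine hS.2.2 ⟨T.map Subtype.val, R, by simpa using hT0, ?_, rfl, hT1', ?_⟩
  · rintro rfl
    simp at hcard
    omega
  · refine IsProductOne.of_add_central (fun g hg => ?_) hT1' hS.2.1
    obtain ⟨x, -, rfl⟩ := Multiset.mem_map.1 hg
    exact x.2

end ProductOneSubsequences

/-- A group all of whose commutators lie in a central subgroup of order `p`, parametrised by `e`,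
and whose quotient by the center embeds into `(ZMod p) ^ 2` by means of `φ`. -/
structure CentralCommutatorData (p : ℕ) (G : Type*) [Group G] where
  /-- the parametrisation of the central subgroup containing the commutators -/
  e : ZMod p → G
  /-- the exponent of the commutator -/
  β : G → G → ZMod p
  /-- the coordinates modulo the center -/
  φ : G → Fin 2 → ZMod p
  e_add : ∀ i j, e (i + j) = e i * e j
  e_comm : ∀ i g, e i * g = g * e i
  mul_eq : ∀ x y, x * y = e (β x y) * (y * x)
  φ_mul : ∀ x y, φ (x * y) = φ x + φ y
  φ_eq_zero : ∀ x, φ x = 0 ↔ x ∈ Subgroup.center G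

namespace CentralCommutatorData

variable {p : ℕ} {G : Type*} [Group G] (D : CentralCommutatorData p G)

lemma e_zero : D.e 0 = 1 := by simpa using D.e_add 0 0

lemma exists_prod_eq_of_perm {l₁ l₂ : List G} (h : l₁.Perm l₂) :
    ∃ i, l₁.prod = D.e i * l₂.prod := by
  induction h with
  | nil => exact ⟨0, by simp [D.e_zero]⟩
  | cons x _ ih =>
    obtain ⟨i, hi⟩ := ih
    exact ⟨i, by rw [List.prod_cons, List.prod_cons, hi, ← mul_assoc, ← D.e_comm, mul_assoc]⟩
  | swap x y l =>
    exact ⟨D.β y x, by simp only [List.prod_cons, ← mul_assoc, D.mul_eq y x]⟩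
  | trans _ _ ih₁ ih₂ =>
    obtain ⟨i, hi⟩ := ih₁
    obtain ⟨j, hj⟩ := ih₂
    exact ⟨i + j, by rw [hi, hj, D.e_add, mul_assoc]⟩

lemma prod_append_cons (y : G) (l₁ l₂ : List G) :
    (l₁ ++ y :: l₂).prod = D.e (l₁.map fun x => D.β x y).sum * (y * (l₁ ++ l₂).prod) := by
  induction l₁ with
  | nil => simp [D.e_zero]
  | cons x l ih =>
    rw [List.cons_append, List.prod_cons, ih, ← mul_assoc, ← D.e_comm, mul_assoc, ← mul_assoc x,
      D.mul_eq x y, List.map_cons, List.sum_cons, add_comm, D.e_add]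
    simp [mul_assoc]

lemma β_ne_zero {x y : G} (h : ¬ Commute x y) : D.β x y ≠ 0 := fun h0 => h <| by
  have := D.mul_eq x y
  rwa [h0, D.e_zero, one_mul] at this

/-- If `X` consists of at least `p - 1` commuting elements, none of which commutes with `y`, then
the set of products of `y ::ₘ X` is a full coset of the central subgroup. -/
lemma e_mul_mem_prodSet [Fact p.Prime] {y : G} {X : Multiset G}
    (hX : p - 1 ≤ Multiset.card X) (hcomm : ∀ a ∈ X, ∀ b ∈ X, Commute a b)
    (hy : ∀ a ∈ X, ¬ Commute a y) {u : G} (hu : u ∈ prodSet (y ::ₘ X)) (d : ZMod p) :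
    D.e d * u ∈ prodSet (y ::ₘ X) := by
  obtain ⟨l, hl, rfl⟩ := hu
  obtain ⟨t, rfl⟩ := Quot.exists_rep X
  obtain ⟨i, hi⟩ := D.exists_prod_eq_of_perm (Quotient.exact hl : l.Perm (y :: t))
  obtain ⟨X₁, X₂, h, hsum⟩ := exists_add_sum_map_eq (f := fun x => D.β x y)
    (fun x hx => D.β_ne_zero (hy x hx)) hX (d + i)
  obtain ⟨l₁, rfl⟩ := Quot.exists_rep X₁
  obtain ⟨l₂, rfl⟩ := Quot.exists_rep X₂
  have hperm : t.Perm (l₁ ++ l₂) := Quotient.exact h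
  refine ⟨l₁ ++ y :: l₂, ?_, ?_⟩
  · exact Multiset.coe_eq_coe.2 (List.perm_middle.trans (hperm.symm.cons y))
  · have hprod : t.prod = (l₁ ++ l₂).prod :=
      hperm.prod_eq' (List.pairwise_of_forall_mem_list fun a ha b hb => hcomm a ha b hb)
    have hsum' : (l₁.map fun x => D.β x y).sum = d + i := hsum
    rw [D.prod_append_cons, hsum', hi, List.prod_cons, hprod, D.e_add, mul_assoc]

lemma φ_list_prod (l : List G) : D.φ l.prod = (l.map D.φ).sum := by
  induction l with
  | nil => exact (D.φ_eq_zero 1).2 (one_mem _)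
  | cons x l ih => simp [D.φ_mul, ih]

lemma exists_blocks [Fact p.Prime] (k : ℕ) (R : Multiset G)
    (hR : p * k + p - 1 ≤ Multiset.card R) :
    ∃ B : Multiset (Multiset G), Multiset.card B = k ∧ B.sum ≤ R ∧
      ∀ b ∈ B, b ≠ 0 ∧ (b.map D.φ).sum = 0 := by
  classical
  have hp2 := (Fact.out : p.Prime).two_le
  induction k generalizing R with
  | zero => exact ⟨0, by simp, by simp, by simp⟩
  | succ k ih =>
    rw [mul_add, mul_one] at hR
    rcases Nat.eq_zero_or_pos k with rfl | hk
    · obtain ⟨T, hT, hT0, hsum⟩ := exists_le_sum_map_eq_zero (p := p) R D.φ (by omega)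
      exact ⟨{T}, by simp, by simpa using hT, by simpa using ⟨hT0, hsum⟩⟩
    · have := Nat.le_mul_of_pos_right p hk
      obtain ⟨T, hT, hT0, hTp, hsum⟩ := exists_short_sum_map_eq_zero (p := p) R D.φ (by omega)
      obtain ⟨B, hB, hBR, hB'⟩ := ih (R - T) (by rw [Multiset.card_sub hT]; omega)
      refine ⟨T ::ₘ B, by simp [hB], ?_, ?_⟩
      · rw [Multiset.sum_cons, add_comm, ← le_tsub_iff_right hT]
        exact hBR
      · rw [Multiset.forall_mem_cons]
        exact ⟨⟨hT0, hsum⟩, hB'⟩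

/-- A sufficiently long sequence has a nontrivial product-one subsequence. -/
lemma exists_le_isProductOne [Fact p.Prime] [Finite G] (D : CentralCommutatorData p G)
    {R : Multiset G}
    (hR : p * Nat.card (Subgroup.center G) + p - 1 ≤ Multiset.card R) :
    ∃ T ≤ R, T ≠ 0 ∧ IsProductOne T := by
  obtain ⟨B, hBcard, hBR, hB⟩ := D.exists_blocks _ R hR
  obtain ⟨B, rfl⟩ : ∃ C : Multiset (List G), C.map (fun l : List G => (l : Multiset G)) = B :=
    ⟨B.map Multiset.toList, by simp [Multiset.map_map]⟩
  have hB' : ∀ b ∈ B, b ≠ [] ∧ b.prod ∈ Subgroup.center G := by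
    intro b hb
    obtain ⟨h0, h1⟩ := hB b (Multiset.mem_map_of_mem _ hb)
    rw [Multiset.map_coe, Multiset.sum_coe, ← D.φ_list_prod, D.φ_eq_zero] at h1
    exact ⟨by simpa using h0, h1⟩
  lift B to Multiset {b : List G // b ≠ [] ∧ b.prod ∈ Subgroup.center G} using hB'
  let f : {b : List G // b ≠ [] ∧ b.prod ∈ Subgroup.center G} → Subgroup.center G :=
    fun b => ⟨b.1.prod, b.2.2⟩
  obtain ⟨T, hT, hT0, hT1⟩ := _root_.exists_le_isProductOne (B.map f)
    (by rw [Multiset.card_map]; simpa using hBcard.ge)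
  obtain ⟨U, hU⟩ := Multiset.le_iff_exists_add.1 hT
  obtain ⟨B₁, B₂, rfl, rfl, rfl⟩ := exists_add_of_map_eq_add hU
  refine ⟨((B₁.map Subtype.val).map fun l : List G => (l : Multiset G)).sum, ?_, ?_, ?_⟩
  · refine le_trans ?_ hBR
    simp
  · refine sum_map_coe_ne_zero (by simpa using hT0) fun b hb => ?_
    obtain ⟨x, -, rfl⟩ := Multiset.mem_map.1 hb
    exact x.2.1
  · refine IsProductOne.sum_of_map_prod ?_
    have := hT1.map (Subgroup.center G).subtype
    simpa [Multiset.map_map, f, Function.comp_def] using this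

variable [Fact p.Prime]

/-- The point of the projective line over `ZMod p` given by `D.φ x`. -/
noncomputable def slope (x : G) : Option (ZMod p) :=
  if D.φ x 1 = 0 then none else some (D.φ x 0 / D.φ x 1)

lemma φ_pow (x : G) (k : ℕ) : D.φ (x ^ k) = k • D.φ x := by
  rw [← List.prod_replicate, D.φ_list_prod, List.map_replicate, List.sum_replicate]

lemma commute_of_slope_eq {x y g : G} (h : D.slope x = D.slope y)
    (hy : y ∉ Subgroup.center G) (hg : Commute g y) : Commute g x := by
  obtain ⟨c, hc⟩ : ∃ c : ZMod p, D.φ x = c • D.φ y := by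
    rw [← D.φ_eq_zero] at hy
    unfold slope at h
    split_ifs at h with hx1 hy1 hy1
    · have hy0 : D.φ y 0 ≠ 0 := fun h0 => hy <| by ext j; fin_cases j <;> simp [h0, hy1]
      refine ⟨D.φ x 0 / D.φ y 0, ?_⟩
      ext j
      fin_cases j
      · simp [hy0]
      · simp [hx1, hy1]
    · refine ⟨D.φ x 1 / D.φ y 1, ?_⟩
      have h' := Option.some.inj h
      ext j
      fin_cases j
      · simp only [Fin.zero_eta, Pi.smul_apply, smul_eq_mul]
        field_simp at h' ⊢
        exact h'
      · simp [hy1]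
  have hz : x * (y ^ c.val)⁻¹ ∈ Subgroup.center G := by
    rw [← D.φ_eq_zero]
    have h1 := D.φ_mul (x * (y ^ c.val)⁻¹) (y ^ c.val)
    rw [inv_mul_cancel_right, D.φ_pow, hc, ← Nat.cast_smul_eq_nsmul (ZMod p),
      ZMod.natCast_zmod_val] at h1
    exact left_eq_add.1 (h1.trans (add_comm _ _))
  have hgz : Commute g (x * (y ^ c.val)⁻¹) := Subgroup.mem_center_iff.1 hz g
  have := hgz.mul_right (hg.pow_right c.val)
  rwa [inv_mul_cancel_right] at this

/-- More than `(p + 1) * (p - 2)` noncentral elements contain `p - 1` elements of equal slope. -/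
lemma exists_le_slope_eq {N : Multiset G} (hN : (p + 1) * (p - 2) < Multiset.card N) :
    ∃ X ≤ N, Multiset.card X = p - 1 ∧ ∀ x ∈ X, ∀ y ∈ X, D.slope x = D.slope y := by
  classical
  have hp2 := (Fact.out : p.Prime).two_le
  obtain ⟨s, hs⟩ : ∃ s, p - 2 < (N.map D.slope).count s := by
    by_contra! hall
    have hle := Finset.sum_le_card_nsmul Finset.univ (fun s => (N.map D.slope).count s) (p - 2)
      (fun q _ => hall q)
    rw [Multiset.sum_count_eq_card (by simp), Multiset.card_map, Finset.card_univ,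
      Fintype.card_option, ZMod.card, smul_eq_mul] at hle
    omega
  rw [Multiset.count_map] at hs
  obtain ⟨X, hX, hcard⟩ := exists_le_card_eq
    (show p - 1 ≤ Multiset.card (N.filter fun a => s = D.slope a) by omega)
  have hmem : ∀ x ∈ X, s = D.slope x := fun x hx =>
    (Multiset.mem_filter.1 (Multiset.mem_of_le hX hx)).2
  exact ⟨X, hX.trans (Multiset.filter_le _ _), hcard, fun x hx y hy =>
    (hmem x hx).symm.trans (hmem y hy)⟩

lemma card_le [Finite G] (D : CentralCommutatorData p G)
    (hindex : ∀ H : Subgroup G, H ≠ ⊤ → Nat.card H ≤ p * Nat.card (Subgroup.center G))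
    (hcenter : p ≤ Nat.card (Subgroup.center G))
    {S : Multiset G} (hS : IsMinimalProductOne S) :
    Multiset.card S ≤ p * Nat.card (Subgroup.center G) + 2 * p - 2 := by
  classical
  have hp2 := (Fact.out : p.Prime).two_le
  by_contra! hlt
  have hpz := Nat.le_mul_of_pos_left (Nat.card (Subgroup.center G)) (show 0 < p by omega)
  have hC := hS.card_filter_center_lt (by omega)
  have hsplit := congrArg Multiset.card (Multiset.filter_add_not (· ∈ Subgroup.center G) S)
  rw [Multiset.card_add] at hsplit
  obtain ⟨X, hXN, hXcard, hslope⟩ := D.exists_le_slope_eq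
    (N := S.filter (· ∉ Subgroup.center G)) (by
      obtain ⟨q, rfl⟩ := Nat.exists_eq_add_of_le hp2
      obtain ⟨w, hw⟩ := Nat.exists_eq_add_of_le hcenter
      rw [hw] at hlt hC
      rw [Nat.add_sub_cancel_left]
      have hlt' : (2 + q) * (2 + q + w) + 2 * q + 2 < Multiset.card S := by omega
      nlinarith)
  have hXS := hXN.trans (Multiset.filter_le _ _)
  have hXnc : ∀ x ∈ X, x ∉ Subgroup.center G := fun x hx =>
    (Multiset.mem_filter.1 (Multiset.mem_of_le hXN hx)).2
  have hXcomm : ∀ a ∈ X, ∀ b ∈ X, Commute a b := fun a ha b hb =>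
    D.commute_of_slope_eq (hslope b hb a ha) (hXnc a ha) (Commute.refl a)
  obtain ⟨x, hx⟩ := Multiset.card_pos_iff_exists_mem.1 (by omega : 0 < Multiset.card X)
  obtain ⟨y, hyS, hyx⟩ : ∃ y ∈ S, ¬ Commute y x := by
    by_contra! hall
    have := hS.card_le_of_forall_mem (Subgroup.centralizer {x}) fun g hg =>
      Subgroup.mem_centralizer_singleton_iff.2 (hall g hg)
    have := hindex (Subgroup.centralizer {x}) fun htop => hXnc x hx <| by
      rw [Subgroup.centralizer_eq_top_iff_subset] at htop
      exact htop rfl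
    omega
  have hyX : ∀ a ∈ X, ¬ Commute a y := fun a ha hay =>
    hyx (D.commute_of_slope_eq (hslope x hx a ha) (hXnc a ha) hay.symm)
  have hU : y ::ₘ X ≤ S :=
    (Multiset.cons_le_of_notMem fun hy => hyx (hXcomm y hy x hx)).2 ⟨hyS, hXS⟩
  obtain ⟨R, rfl⟩ := Multiset.le_iff_exists_add.1 hU
  rw [Multiset.card_add, Multiset.card_cons, hXcard] at hlt
  obtain ⟨T, hT, hT0, hT1⟩ := D.exists_le_isProductOne (R := R) (by omega)
  obtain ⟨W, rfl⟩ := Multiset.le_iff_exists_add.1 hT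
  refine hS.2.2 ⟨T, (y ::ₘ X) + W, hT0, by simp, by abel, hT1, ?_⟩
  obtain ⟨w, rfl⟩ := Quot.exists_rep W
  obtain ⟨t, ht, ht1⟩ := hT1
  obtain ⟨u, hu⟩ := Quot.exists_rep (y ::ₘ X)
  obtain ⟨l, hl, hl1⟩ := hS.2.1
  obtain ⟨i, hi⟩ := D.exists_prod_eq_of_perm (l₁ := l) (l₂ := u ++ w ++ t) <| by
    rw [← Multiset.coe_eq_coe, hl, ← Multiset.coe_add, ← Multiset.coe_add, ht, ← hu]
    change (u : Multiset G) + (T + (w : Multiset G)) = _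
    abel
  rw [hl1, List.prod_append, List.prod_append, ht1, mul_one, ← mul_assoc] at hi
  have hfull := D.e_mul_mem_prodSet hXcard.ge hXcomm hyX ⟨u, hu, rfl⟩ i
  have := mul_mem_prodSet_add hfull (⟨w, rfl, rfl⟩ : w.prod ∈ prodSet (w : Multiset G))
  rwa [← hi] at this

end CentralCommutatorData

section MinimalNonabelian

variable {p : ℕ} [Fact p.Prime] {G : Type*} [Group G]

lemma exists_normal_index_eq [Finite G] {n : ℕ} (hG : Nat.card G = p ^ n)
    (hna : ¬ ∀ a b : G, a * b = b * a) (x : G) :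
    ∃ M : Subgroup G, M.Normal ∧ M.index = p ∧ x ∈ M := by
  have hp : p.Prime := Fact.out
  have hx : Subgroup.zpowers x ≠ ⊤ := fun h => hna fun a b => by
    obtain ⟨i, rfl⟩ := Subgroup.mem_zpowers_iff.1 (h ▸ Subgroup.mem_top a)
    obtain ⟨j, rfl⟩ := Subgroup.mem_zpowers_iff.1 (h ▸ Subgroup.mem_top b)
    exact zpow_mul_comm x i j
  obtain ⟨k, hkn, hk⟩ := (Nat.dvd_prime_pow hp).1
    (hG ▸ (Subgroup.zpowers x).card_subgroup_dvd_card)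
  have hlt : k < n := by
    refine lt_of_le_of_ne hkn ?_
    rintro rfl
    exact hx ((Subgroup.zpowers x).card_eq_iff_eq_top.1 (hk.trans hG.symm))
  obtain ⟨m, rfl⟩ := Nat.exists_eq_succ_of_ne_zero (by omega : n ≠ 0)
  obtain ⟨M, hM, hxM⟩ := Sylow.exists_subgroup_card_pow_prime_le p
    (hG ▸ pow_dvd_pow p m.le_succ) (Subgroup.zpowers x) hk (by omega)
  have hindex : M.index = p := by
    have := M.card_mul_index
    rw [hM, hG, pow_succ] at this
    exact Nat.eq_of_mul_eq_mul_left (pow_pos hp.pos m) this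
  refine ⟨M, Subgroup.normal_of_index_eq_minFac_card ?_, hindex,
    hxM (Subgroup.mem_zpowers x)⟩
  rw [hindex, hG, hp.pow_minFac (Nat.succ_ne_zero m)]

/-- In a nonabelian `p`-group generated by `a` and `b` all of whose proper subgroups are abelian,
the commutator of `a` and `b` is central of order `p`. -/
lemma exists_central_commutator [Finite G] {n : ℕ} (hG : Nat.card G = p ^ n)
    (hmin : ∀ H : Subgroup G, H ≠ ⊤ → ∀ a ∈ H, ∀ b ∈ H, a * b = b * a) {a b : G}
    (hab : a * b ≠ b * a)
    (hcen : ∀ x : G, x * a = a * x → x * b = b * x → x ∈ Subgroup.center G) :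
    ∃ c ∈ Subgroup.center G, orderOf c = p ∧ a * b = c * (b * a) := by
  have hp : p.Prime := Fact.out
  have hna : ¬ ∀ a b : G, a * b = b * a := fun h => hab (h a b)
  obtain ⟨A, hA, hAi, haA⟩ := exists_normal_index_eq hG hna a
  obtain ⟨B, hB, hBi, hbB⟩ := exists_normal_index_eq hG hna b
  have hne {M : Subgroup G} (h : M.index = p) : M ≠ ⊤ := by
    rintro rfl
    rw [Subgroup.index_top] at h
    exact hp.one_lt.ne h
  have hc : a * b * a⁻¹ * b⁻¹ ∈ Subgroup.center G := by
    refine hcen _ (hmin A (hne hAi) _ ?_ _ haA) (hmin B (hne hBi) _ ?_ _ hbB)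
    · rw [mul_assoc a, mul_assoc a]
      exact mul_mem haA (hA.conj_mem _ (inv_mem haA) b)
    · exact mul_mem (hB.conj_mem _ hbB a) (inv_mem hbB)
  set c := a * b * a⁻¹ * b⁻¹ with hc'
  have hcab : a * b = c * (b * a) := by simp [hc', mul_assoc]
  refine ⟨c, hc, orderOf_eq_prime ?_ ?_, hcab⟩
  · have hpow (k : ℕ) : a ^ k * b = c ^ k * (b * a ^ k) := by
      induction k with
      | zero => simp
      | succ k ih =>
        rw [pow_succ', mul_assoc, ih, ← mul_assoc, Subgroup.mem_center_iff.1 (pow_mem hc k),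
          mul_assoc, ← mul_assoc a b, hcab, pow_succ]
        simp only [mul_assoc]
    have h := hpow p
    rw [hmin B (hne hBi) _ (hBi ▸ B.pow_index_mem a) b hbB] at h
    exact mul_eq_right.1 h.symm
  · intro h1
    exact hab (by rw [hcab, h1, one_mul])

lemma exists_mul_eq_of_closure_eq_top {e : ZMod p → G} (he : ∀ i j, e (i + j) = e i * e j)
    (hcomm : ∀ i g, e i * g = g * e i) {a b : G} (htop : Subgroup.closure {a, b} = ⊤) {y : G}
    (ha : ∃ i, a * y = e i * (y * a)) (hb : ∃ i, b * y = e i * (y * b)) (x : G) :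
    ∃ i, x * y = e i * (y * x) := by
  have he0 : e 0 = 1 := by simpa using he 0 0
  have hx : x ∈ Subgroup.closure {a, b} := htop ▸ Subgroup.mem_top x
  induction hx using Subgroup.closure_induction with
  | mem x hx =>
    rcases hx with rfl | rfl
    · exact ha
    · exact hb
  | one => exact ⟨0, by simp [he0]⟩
  | mul x z _ _ ihx ihz =>
    obtain ⟨i, hi⟩ := ihx
    obtain ⟨j, hj⟩ := ihz
    refine ⟨j + i, ?_⟩
    rw [mul_assoc, hj, ← mul_assoc, ← hcomm, mul_assoc, ← mul_assoc x, hi, he]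
    simp only [mul_assoc]
  | inv x _ ih =>
    obtain ⟨i, hi⟩ := ih
    refine ⟨-i, ?_⟩
    have h1 : y * x⁻¹ = e i * (x⁻¹ * y) := by
      calc
        y * x⁻¹ = x⁻¹ * (x * y) * x⁻¹ := by group
        _ = x⁻¹ * (e i * (y * x)) * x⁻¹ := by rw [hi]
        _ = (x⁻¹ * e i) * y := by group
        _ = e i * (x⁻¹ * y) := by rw [← hcomm, mul_assoc]
    rw [h1, ← mul_assoc, ← he, neg_add_cancel, he0, one_mul]

lemma card_center_and_data [Finite G] {n : ℕ} (hG : Nat.card G = p ^ n)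
    (hna : ¬ ∀ a b : G, a * b = b * a)
    (hmin : ∀ H : Subgroup G, H ≠ ⊤ → ∀ a ∈ H, ∀ b ∈ H, a * b = b * a) :
    Nonempty (CentralCommutatorData p G) ∧ p ≤ Nat.card (Subgroup.center G) ∧
      Nat.card G = p ^ 2 * Nat.card (Subgroup.center G) := by
  have hp : p.Prime := Fact.out
  push Not at hna
  obtain ⟨a, b, hab⟩ := hna
  have htop : Subgroup.closure {a, b} = ⊤ := by
    by_contra h
    exact hab (hmin _ h a (Subgroup.subset_closure (by simp)) b (Subgroup.subset_closure (by simp)))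
  have hcen (x : G) (ha : x * a = a * x) (hb : x * b = b * x) : x ∈ Subgroup.center G := by
    have hle : Subgroup.closure {a, b} ≤ Subgroup.centralizer {x} := by
      rw [Subgroup.closure_le]
      rintro y (rfl | rfl)
      · exact Subgroup.mem_centralizer_singleton_iff.2 ha.symm
      · exact Subgroup.mem_centralizer_singleton_iff.2 hb.symm
    rw [htop] at hle
    exact Subgroup.mem_center_iff.2 fun g =>
      Subgroup.mem_centralizer_singleton_iff.1 (hle (Subgroup.mem_top g))
  obtain ⟨c, hc, hcp, hcab⟩ := exists_central_commutator hG hmin hab hcen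
  let e : ZMod p → G := fun i => c ^ i.val
  have e_add (i j : ZMod p) : e (i + j) = e i * e j := by
    simp only [e]
    rw [ZMod.val_add, ← pow_add, ← pow_eq_pow_mod _ (hcp ▸ pow_orderOf_eq_one c : c ^ p = 1)]
  have e_mem (i : ZMod p) : e i ∈ Subgroup.center G := pow_mem hc _
  have e_comm (i : ZMod p) (g : G) : e i * g = g * e i :=
    (Subgroup.mem_center_iff.1 (e_mem i) g).symm
  have e_inj : Function.Injective e := fun i j h => ZMod.val_injective p <|
    pow_injOn_Iio_orderOf (by simpa [hcp] using i.val_lt) (by simpa [hcp] using j.val_lt) h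
  have e_zero : e 0 = 1 := by simp [e]
  have hsymm {x y : G} : (∃ i, x * y = e i * (y * x)) → ∃ i, y * x = e i * (x * y) := by
    rintro ⟨i, hi⟩
    exact ⟨-i, by rw [hi, ← mul_assoc, ← e_add, neg_add_cancel, e_zero, one_mul]⟩
  have hself (x : G) : ∃ i, x * x = e i * (x * x) := ⟨0, by rw [e_zero, one_mul]⟩
  have habe : ∃ i, a * b = e i * (b * a) := ⟨1, by
    have := hp.one_lt
    simpa [e, ZMod.val_one'' hp.ne_one] using hcab⟩
  have hall (x y : G) : ∃ i, x * y = e i * (y * x) :=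
    exists_mul_eq_of_closure_eq_top e_add e_comm htop
      (hsymm (exists_mul_eq_of_closure_eq_top e_add e_comm htop (hself a) (hsymm habe) y))
      (hsymm (exists_mul_eq_of_closure_eq_top e_add e_comm htop habe (hself b) y)) x
  choose β hβ using hall
  have β_mul (x y g : G) : β (x * y) g = β x g + β y g := by
    apply e_inj
    have h := hβ (x * y) g
    rw [mul_assoc, hβ y g, ← mul_assoc, ← e_comm, mul_assoc, ← mul_assoc x, hβ x g, mul_assoc,
      mul_assoc g, ← mul_assoc, ← e_add, add_comm] at h
    exact (mul_right_cancel h).symm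
  have β_eq_zero (x g : G) : β x g = 0 ↔ x * g = g * x := by
    constructor
    · intro h
      rw [hβ x g, h, e_zero, one_mul]
    · intro h
      have := hβ x g
      rw [h] at this
      exact e_inj (by rw [e_zero]; exact mul_eq_right.1 this.symm)
  let D : CentralCommutatorData p G :=
    { e, β, e_add, e_comm
      mul_eq := hβ
      φ := fun x => ![β x a, β x b]
      φ_mul := fun x y => by ext j; fin_cases j <;> simp [β_mul]
      φ_eq_zero := fun x => by
        constructor
        · intro h
          exact hcen x ((β_eq_zero x a).1 (congrFun h 0)) ((β_eq_zero x b).1 (congrFun h 1))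
        · intro h
          have h' (g : G) : β x g = 0 := (β_eq_zero x g).2 (Subgroup.mem_center_iff.1 h g).symm
          ext j
          fin_cases j <;> simp [h'] }
  refine ⟨⟨D⟩, ?_, ?_⟩
  · have := Nat.card_le_card_of_injective (fun i => (⟨e i, e_mem i⟩ : Subgroup.center G))
      fun i j h => e_inj (congrArg Subtype.val h)
    rwa [Nat.card_zmod] at this
  · let f : G →* Multiplicative (Fin 2 → ZMod p) :=
      MonoidHom.mk' (fun x => Multiplicative.ofAdd (D.φ x)) fun x y => by rw [D.φ_mul]; rfl
    have hker : f.ker = Subgroup.center G := by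
      ext x
      exact (ofAdd_eq_one.trans (D.φ_eq_zero x))
    have hsurj : Function.Surjective f := by
      intro v
      have hu : β a b ≠ 0 := fun h => hab ((β_eq_zero a b).1 h)
      have hw : β b a ≠ 0 := fun h => hab ((β_eq_zero b a).1 h).symm
      refine ⟨a ^ (v.toAdd 1 / β a b).val * b ^ (v.toAdd 0 / β b a).val, ?_⟩
      apply Multiplicative.toAdd.injective
      change D.φ _ = v.toAdd
      rw [D.φ_mul, D.φ_pow, D.φ_pow, ← Nat.cast_smul_eq_nsmul (ZMod p),
        ← Nat.cast_smul_eq_nsmul (ZMod p), ZMod.natCast_zmod_val, ZMod.natCast_zmod_val]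
      have haa : β a a = 0 := (β_eq_zero a a).2 rfl
      have hbb : β b b = 0 := (β_eq_zero b b).2 rfl
      ext j
      fin_cases j <;> simp [D, haa, hbb, hu, hw]
    have hidx := Subgroup.index_ker f
    rw [hker, MonoidHom.range_eq_top.2 hsurj, Subgroup.card_top] at hidx
    rw [← (Subgroup.center G).index_mul_card, hidx]
    congr 1
    simp [Nat.card_eq_fintype_card]

end MinimalNonabelian

section PGroups

variable {p : ℕ} [Fact p.Prime]

lemma mul_card_le_card {n : ℕ} {G : Type*} [Group G] (hG : Nat.card G = p ^ n) (H : Subgroup G)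
    (hH : H ≠ ⊤) : p * Nat.card H ≤ Nat.card G := by
  rw [← H.card_mul_index, mul_comm p]
  obtain ⟨k, -, hk⟩ := (Nat.dvd_prime_pow Fact.out).1 (hG ▸ H.index_dvd_card)
  rw [hk]
  refine Nat.mul_le_mul_left _ (Nat.le_self_pow ?_ p)
  rintro rfl
  exact hH (Subgroup.index_eq_one.1 (by simpa using hk))

/-- The bound for a single minimal product-one sequence. -/
lemma IsMinimalProductOne.pow_three_mul_card_le (n : ℕ) {G : Type*} [Group G]
    (hG : Nat.card G = p ^ n) (hna : ¬ ∀ a b : G, a * b = b * a) {S : Multiset G}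
    (hS : IsMinimalProductOne S) :
    p ^ 3 * Multiset.card S ≤ (p ^ 2 + 2 * p - 2) * Nat.card G := by
  induction n using Nat.strong_induction_on generalizing G with
  | h n ih =>
  have hp : p.Prime := Fact.out
  have : Finite G := Nat.finite_of_card_ne_zero (by rw [hG]; exact pow_ne_zero _ hp.ne_zero)
  by_cases hmin : ∀ H : Subgroup G, H ≠ ⊤ → ∀ a ∈ H, ∀ b ∈ H, a * b = b * a
  · obtain ⟨⟨D⟩, hcenter, hcard⟩ := card_center_and_data hG hna hmin
    have hle := D.card_le (fun H hH => ?_) hcenter hS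
    · rw [hcard]
      have hp2 := hp.two_le
      obtain ⟨q, rfl⟩ := Nat.exists_eq_add_of_le hp2
      set z := Nat.card (Subgroup.center G)
      have e1 : (2 + q) ^ 2 + 2 * (2 + q) - 2 = (2 + q) ^ 2 + 2 * q + 2 := by omega
      have e2 : (2 + q) * z + 2 * (2 + q) - 2 = (2 + q) * z + 2 * q + 2 := by omega
      rw [e1]
      rw [e2] at hle
      calc (2 + q) ^ 3 * Multiset.card S
          ≤ (2 + q) ^ 3 * ((2 + q) * z + 2 * q + 2) := Nat.mul_le_mul_left _ hle
        _ = (2 + q) ^ 2 * ((2 + q) ^ 2 * z + (2 * q + 2) * (2 + q)) := by ring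
        _ ≤ (2 + q) ^ 2 * ((2 + q) ^ 2 * z + (2 * q + 2) * z) := by gcongr
        _ = _ := by ring
    · have := mul_card_le_card hG H hH
      rw [hcard, pow_two, mul_assoc] at this
      exact Nat.le_of_mul_le_mul_left this hp.pos
  · push Not at hmin
    obtain ⟨H, hH, a, ha, b, hb, hab⟩ := hmin
    obtain ⟨k, hkn, hk⟩ := (Nat.dvd_prime_pow hp).1 (hG ▸ H.card_subgroup_dvd_card)
    have hlt : k < n := by
      refine lt_of_le_of_ne hkn ?_
      rintro rfl
      exact hH (H.card_eq_iff_eq_top.1 (hk.trans hG.symm))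
    have hpos : 0 < p ^ 3 := pow_pos hp.pos 3
    have hbound (T : Multiset H) (hT : IsMinimalProductOne T) :
        Multiset.card T ≤ (p ^ 2 + 2 * p - 2) * Nat.card H / p ^ 3 := by
      rw [Nat.le_div_iff_mul_le hpos, mul_comm]
      exact ih k hlt hk (fun h => hab (congrArg Subtype.val (h ⟨a, ha⟩ ⟨b, hb⟩))) hT
    calc p ^ 3 * Multiset.card S
        ≤ p ^ 3 * (H.index * ((p ^ 2 + 2 * p - 2) * Nat.card H / p ^ 3)) :=
          Nat.mul_le_mul_left _ (hS.card_le_index_mul H hbound)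
      _ = H.index * (p ^ 3 * ((p ^ 2 + 2 * p - 2) * Nat.card H / p ^ 3)) := by ring
      _ ≤ H.index * ((p ^ 2 + 2 * p - 2) * Nat.card H) :=
          Nat.mul_le_mul_left _ (Nat.mul_div_le _ _)
      _ = (p ^ 2 + 2 * p - 2) * Nat.card G := by rw [← H.card_mul_index]; ring

end PGroups

theorem stmt3 (G : Type*) [Group G] [Finite G] (p : ℕ) (hp : p.Prime)
    (hpgroup : ∃ n : ℕ, Nat.card G = p ^ n)
    (hna : ¬ ∀ a b : G, a * b = b * a) :
    p ^ 3 * largeDavenport G ≤ (p ^ 2 + 2 * p - 2) * Nat.card G := by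
  have : Fact p.Prime := ⟨hp⟩
  obtain ⟨n, hn⟩ := hpgroup
  have hpos : 0 < p ^ 3 := pow_pos hp.pos 3
  rw [mul_comm, ← Nat.le_div_iff_mul_le hpos]
  refine csSup_le' ?_
  rintro _ ⟨S, rfl, hS⟩
  rw [Nat.le_div_iff_mul_le hpos, mul_comm]
  exact hS.pow_three_mul_card_le n hn hna
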